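/- arXiv:1811.08387 — 5 statements merged into one kernel-verified Lean document; each statement's English description precedes it below -/
import Mathlib

section
/- Let Y be a real Banach space and n a positive integer. The mapping Φ : L(ℓ∞ⁿ, Y) → Yⁿ given by Φ(T) = (T(v₁ⁿ), …, T(vₙⁿ)) is a linear bijection. Moreover, for every T ∈ L(ℓ∞ⁿ, Y), ‖T‖ = max{ ‖T(∑_{j=1}^{k} (−1)^{j+1} v_{i_j}ⁿ)‖ : (i₁,…,i_k) ∈ 𝓘ₙ }, and consequently Φ maps the closed unit ball of L(ℓ∞ⁿ, Y) onto M_Yⁿ. -/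
open scoped BigOperators

noncomputable section

def vvec (n : ℕ) (i : Fin n) : Fin n → ℝ :=
  fun j => if 0 < (j : ℕ) ∧ (j : ℕ) ≤ (i : ℕ) then -1 else 1

def MSet (Y : Type*) [NormedAddCommGroup Y] [NormedSpace ℝ Y] (n : ℕ) :
    Set (Fin n → Y) :=
  {y | ∀ k : ℕ, Odd k → k ≤ n → ∀ c : Fin k → Fin n, StrictMono c →
    ‖∑ j : Fin k, ((-1 : ℝ) ^ (j : ℕ)) • y (c j)‖ ≤ 1}

def AHSpWith (Y : Type*) [NormedAddCommGroup Y] [NormedSpace ℝ Y] (n : ℕ)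
    (γ : ℝ → ℝ) : Prop :=
  ∀ ε : ℝ, 0 < ε → ε < 1 →
    (0 < γ ε ∧ γ ε < ε) ∧
    ∀ y ∈ MSet Y n, ∀ A : Finset (Fin n), A.Nonempty →
      ∀ f : Y →L[ℝ] ℝ, ‖f‖ = 1 → (∀ i ∈ A, 1 - γ ε < f (y i)) →
        ∃ z ∈ MSet Y n, (∀ i, ‖z i - y i‖ < ε) ∧ ‖∑ i ∈ A, z i‖ = (A.card : ℝ)

def AHSp (Y : Type*) [NormedAddCommGroup Y] [NormedSpace ℝ Y] (n : ℕ) : Prop :=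
  ∀ ε : ℝ, 0 < ε → ε < 1 → ∃ γ : ℝ, 0 < γ ∧ γ < ε ∧
    ∀ y ∈ MSet Y n, ∀ A : Finset (Fin n), A.Nonempty →
      ∀ f : Y →L[ℝ] ℝ, ‖f‖ = 1 → (∀ i ∈ A, 1 - γ < f (y i)) →
        ∃ z ∈ MSet Y n, (∀ i, ‖z i - y i‖ < ε) ∧ ‖∑ i ∈ A, z i‖ = (A.card : ℝ)

def BPBpWith (X Y : Type*) [NormedAddCommGroup X] [NormedSpace ℝ X]
    [NormedAddCommGroup Y] [NormedSpace ℝ Y] (η : ℝ → ℝ) : Prop :=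
  ∀ ε : ℝ, 0 < ε → ε < 1 →
    (0 < η ε ∧ η ε < ε) ∧
    ∀ T : X →L[ℝ] Y, ‖T‖ = 1 → ∀ x₀ : X, ‖x₀‖ = 1 → 1 - η ε < ‖T x₀‖ →
      ∃ S : X →L[ℝ] Y, ‖S‖ = 1 ∧ ∃ u₀ : X, ‖u₀‖ = 1 ∧
        ‖S u₀‖ = 1 ∧ ‖u₀ - x₀‖ < ε ∧ ‖S - T‖ < ε

def IsOneNorming {Y : Type*} [NormedAddCommGroup Y] [NormedSpace ℝ Y]
    (B : Set (Y →L[ℝ] ℝ)) : Prop :=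
  (∀ f ∈ B, ‖f‖ = 1) ∧ ∀ y : Y, ‖y‖ = sSup ((fun f : Y →L[ℝ] ℝ => |f y|) '' B)

def tauMap (Y : Type*) [Neg Y] (n : ℕ) (y : Fin n → Y) : Fin n → Y :=
  fun i => if h : (i : ℕ) + 1 < n then y ⟨(i : ℕ) + 1, h⟩ else -y ⟨0, i.pos⟩

def ustar (x : lp (fun _ : ℕ => ℝ) 1) : ℝ := ∑' k, x k

lemma sum_range_neg_one_pow_mul_ite (m k : ℕ) (hm : m ≤ k) :
    ∑ l ∈ Finset.range k, (-1 : ℝ) ^ l * (if l < m then 1 else -1) =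
      (1 - (-1) ^ m) - (1 - (-1) ^ k) / 2 := by
  induction k, hm using Nat.le_induction with
  | base =>
    have h : ∀ l ∈ Finset.range m, (-1 : ℝ) ^ l * (if l < m then 1 else -1) = (-1) ^ l := by
      intro l hl
      simp [Finset.mem_range.mp hl]
    rw [Finset.sum_congr rfl h, geom_sum_eq (by norm_num)]
    ring
  | succ k hk ih =>
    rw [Finset.sum_range_succ, ih, if_neg (by omega)]
    ring

lemma Fin.lt_card_filter_iff_of_strictMono {k n : ℕ} {c : Fin k → Fin n} (hc : StrictMono c)
    (j : Fin n) (l : Fin k) :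
    c l < j ↔ (l : ℕ) < (Finset.univ.filter fun i => c i < j).card := by
  constructor
  · intro h
    have hsub : Finset.Iic l ⊆ Finset.univ.filter fun i => c i < j := by
      intro i hi
      simpa using (hc.monotone (Finset.mem_Iic.mp hi)).trans_lt h
    have := Finset.card_le_card hsub
    rw [Fin.card_Iic] at this
    omega
  · contrapose!
    intro h
    have hsub : (Finset.univ.filter fun i => c i < j) ⊆ Finset.Iio l := by
      intro i hi
      rw [Finset.mem_Iio]
      exact hc.lt_iff_lt.mp ((Finset.mem_filter.mp hi).2.trans_le h)
    simpa using Finset.card_le_card hsub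

lemma alternating_sum_vvec_apply {k n : ℕ} (hk : Odd k) {c : Fin k → Fin n} (hc : StrictMono c)
    (j : Fin n) :
    (∑ l : Fin k, ((-1 : ℝ) ^ (l : ℕ)) • vvec n (c l)) j =
      if (j : ℕ) = 0 then 1 else -(-1) ^ (Finset.univ.filter fun i => c i < j).card := by
  have hval : ∀ m ≤ k, (∀ l : Fin k, vvec n (c l) j = if (l : ℕ) < m then 1 else -1) →
      (∑ l : Fin k, ((-1 : ℝ) ^ (l : ℕ)) • vvec n (c l)) j = -(-1) ^ m := by
    intro m hm h
    simp only [Finset.sum_apply, Pi.smul_apply, smul_eq_mul, h]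
    rw [Fin.sum_univ_eq_sum_range (fun l => (-1 : ℝ) ^ l * (if l < m then 1 else -1)),
      sum_range_neg_one_pow_mul_ite m k hm, hk.neg_one_pow]
    ring
  split_ifs with hj
  · rw [hval k le_rfl (by intro l; simp [vvec, hj]), hk.neg_one_pow, neg_neg]
  · refine hval _ (by simpa using Finset.card_filter_le Finset.univ fun i => c i < j) fun l => ?_
    simp only [vvec, ← Fin.lt_card_filter_iff_of_strictMono hc]
    simp only [Fin.lt_def]
    split_ifs <;> first | rfl | omega

lemma norm_alternating_sum_vvec_le_one {k n : ℕ} (hk : Odd k) {c : Fin k → Fin n}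
    (hc : StrictMono c) : ‖∑ l : Fin k, ((-1 : ℝ) ^ (l : ℕ)) • vvec n (c l)‖ ≤ 1 := by
  rw [pi_norm_le_iff_of_nonneg zero_le_one]
  intro j
  rw [alternating_sum_vvec_apply hk hc]
  split_ifs <;> simp

/-- The parity of the number of switches of `e` before `j` records the value of `e` at `j`. -/
lemma odd_card_switches_iff {n : ℕ} (e : ℕ → Prop) (h0 : ¬ e 0) [DecidablePred e] (j : ℕ)
    (hj : j ≤ n) :
    Odd (Finset.univ.filter fun i : Fin n => ¬ (e i ↔ e (i + 1)) ∧ (i : ℕ) < j).card ↔ e j := by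
  induction j with
  | zero => simp [h0]
  | succ j ih =>
    have ih := ih (by omega)
    by_cases h : e j ↔ e (j + 1)
    · rw [← h, ← ih]
      congr! 3 with i
      refine and_congr_right fun hi => ?_
      have : (i : ℕ) ≠ j := by rintro rfl; exact hi h
      omega
    · have hins : (Finset.univ.filter fun i : Fin n => ¬ (e i ↔ e (i + 1)) ∧ (i : ℕ) < j + 1) =
          insert ⟨j, hj⟩
            (Finset.univ.filter fun i : Fin n => ¬ (e i ↔ e (i + 1)) ∧ (i : ℕ) < j) := by
        ext i
        simp only [Finset.mem_filter, Finset.mem_univ, true_and, Finset.mem_insert, Fin.ext_iff]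
        constructor
        · rintro ⟨h1, h2⟩
          by_cases hij : (i : ℕ) = j
          · exact Or.inl hij
          · exact Or.inr ⟨h1, by omega⟩
        · rintro (hij | ⟨h1, h2⟩)
          · exact ⟨by rwa [hij], by omega⟩
          · exact ⟨h1, by omega⟩
      rw [hins, Finset.card_insert_of_notMem (by simp), Nat.odd_add_one, ih]
      tauto

lemma exists_alternating_sum_vvec_eq {n : ℕ} (hn : 0 < n) (s : Fin n → ℝ)
    (hs : ∀ j, s j = -1 ∨ s j = 1) (h0 : s ⟨0, hn⟩ = 1) :
    ∃ k : ℕ, Odd k ∧ k ≤ n ∧ ∃ c : Fin k → Fin n, StrictMono c ∧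
      ∑ l : Fin k, ((-1 : ℝ) ^ (l : ℕ)) • vvec n (c l) = s := by
  classical
  let e : ℕ → Prop := fun j => n ≤ j ∨ ∃ h : j < n, 0 < j ∧ s ⟨j, h⟩ = 1
  have he0 : ¬ e 0 := by simp [e]; omega
  let A : Finset (Fin n) := Finset.univ.filter fun i => ¬ (e i ↔ e (i + 1))
  have hodd : ∀ j ≤ n, (Odd (A.filter fun i : Fin n => (i : ℕ) < j).card ↔ e j) := by
    intro j hj
    rw [Finset.filter_filter]
    exact odd_card_switches_iff e he0 j hj
  have hA : Odd A.card := by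
    have := (hodd n le_rfl).mpr (Or.inl le_rfl)
    rwa [Finset.filter_true_of_mem fun (i : Fin n) _ => i.isLt] at this
  refine ⟨A.card, hA, by simpa using A.card_le_univ, A.orderEmbOfFin rfl,
    (A.orderEmbOfFin rfl).strictMono, ?_⟩
  ext j
  rw [alternating_sum_vvec_apply hA (A.orderEmbOfFin rfl).strictMono]
  split_ifs with hj
  · rw [← h0]
    exact congrArg s (Fin.ext hj.symm)
  · have hcard : (Finset.univ.filter fun i => A.orderEmbOfFin rfl i < j).card =
        (A.filter fun i : Fin n => (i : ℕ) < j).card := by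
      conv_rhs => rw [← Finset.image_orderEmbOfFin_univ A rfl, Finset.filter_image,
        Finset.card_image_of_injective _ (A.orderEmbOfFin rfl).injective]
      rfl
    have hj' : e j ↔ s j = 1 := by
      have := j.isLt
      simp only [e, not_le.mpr this, false_or]
      exact ⟨fun ⟨_, _, h⟩ => h, fun h => ⟨this, Nat.pos_of_ne_zero hj, h⟩⟩
    rw [hcard]
    rcases hs j with h | h
    · have : ¬ e j := by rw [hj', h]; norm_num
      rw [← hodd j j.isLt.le, Nat.not_odd_iff_even] at this
      rw [this.neg_one_pow, h]
    · have := hj'.mpr h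
      rw [← hodd j j.isLt.le] at this
      rw [this.neg_one_pow, h, neg_neg]

lemma exists_sign_vector_norm_ge {ι Y : Type*} [Fintype ι] [NormedAddCommGroup Y]
    [NormedSpace ℝ Y] (T : (ι → ℝ) →L[ℝ] Y) (x : ι → ℝ) (hx : ‖x‖ ≤ 1) :
    ∃ s : ι → ℝ, (∀ j, s j = -1 ∨ s j = 1) ∧ ‖T x‖ ≤ ‖T s‖ := by
  have hmem : x ∈ convexHull ℝ (Set.univ.pi fun _ : ι => ({-1, 1} : Set ℝ)) := by
    rw [convexHull_pi]
    intro j _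
    rw [convexHull_pair, segment_eq_Icc (by norm_num)]
    exact abs_le.mp ((norm_le_pi_norm x j).trans hx)
  have hconv : ConvexOn ℝ Set.univ fun x => ‖T x‖ :=
    convexOn_univ_norm.comp_linearMap T.toLinearMap
  obtain ⟨s, hs, h⟩ := hconv.exists_ge_of_mem_convexHull (Set.subset_univ _) hmem
  exact ⟨s, fun j => hs j trivial, h⟩

lemma exists_sign_vector_norm_eq {ι Y : Type*} [Fintype ι] [NormedAddCommGroup Y]
    [NormedSpace ℝ Y] (T : (ι → ℝ) →L[ℝ] Y) :
    ∃ s : ι → ℝ, (∀ j, s j = -1 ∨ s j = 1) ∧ ‖T s‖ = ‖T‖ := by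
  obtain ⟨s, hs, hmax⟩ := Set.exists_max_image
    (Set.univ.pi fun _ : ι => ({-1, 1} : Set ℝ)) (fun x => ‖T x‖)
    (Set.Finite.pi' (fun _ => Set.toFinite _) |>.subset fun x hx j => hx j trivial)
    ⟨fun _ => 1, fun _ _ => by simp⟩
  refine ⟨s, fun j => hs j trivial, le_antisymm ?_ ?_⟩
  · refine T.unit_le_opNorm s ((pi_norm_le_iff_of_nonneg zero_le_one).mpr fun j => ?_)
    have h : s j = -1 ∨ s j = 1 := hs j trivial
    rcases h with h | h <;> simp [h]
  · refine T.opNorm_le_of_unit_norm (norm_nonneg _) fun x hx => ?_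
    obtain ⟨t, ht, h⟩ := exists_sign_vector_norm_ge T x hx.le
    exact h.trans (hmax t fun j _ => ht j)

lemma exists_norm_alternating_sum_vvec_eq {n : ℕ} (hn : 0 < n) {Y : Type*}
    [NormedAddCommGroup Y] [NormedSpace ℝ Y] (T : (Fin n → ℝ) →L[ℝ] Y) :
    ∃ k : ℕ, Odd k ∧ k ≤ n ∧ ∃ c : Fin k → Fin n, StrictMono c ∧
      ‖T (∑ j : Fin k, ((-1 : ℝ) ^ (j : ℕ)) • vvec n (c j))‖ = ‖T‖ := by
  obtain ⟨s, hs, hT⟩ := exists_sign_vector_norm_eq T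
  obtain ⟨t, ht, ht0, hTt⟩ : ∃ t : Fin n → ℝ, (∀ j, t j = -1 ∨ t j = 1) ∧ t ⟨0, hn⟩ = 1 ∧
      ‖T t‖ = ‖T‖ := by
    rcases hs ⟨0, hn⟩ with h | h
    · refine ⟨-s, fun j => ?_, by simp [h], by rw [map_neg, norm_neg, hT]⟩
      rcases hs j with h | h <;> simp [h]
    · exact ⟨s, hs, h, hT⟩
  obtain ⟨k, hk, hkn, c, hc, hsum⟩ := exists_alternating_sum_vvec_eq hn t ht ht0
  exact ⟨k, hk, hkn, c, hc, by rw [hsum, hTt]⟩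

lemma span_range_vvec {n : ℕ} (hn : 0 < n) :
    Submodule.span ℝ (Set.range (vvec n)) = ⊤ := by
  rw [eq_top_iff, ← (Pi.basisFun ℝ (Fin n)).span_eq, Submodule.span_le]
  rintro _ ⟨j, rfl⟩
  have hv : ∀ i, vvec n i ∈ Submodule.span ℝ (Set.range (vvec n)) :=
    fun i => Submodule.subset_span ⟨i, rfl⟩
  rw [SetLike.mem_coe, Pi.basisFun_apply]
  by_cases hj : (j : ℕ) = 0
  · have : Pi.single j (1 : ℝ) = (1 / 2 : ℝ) • (vvec n ⟨0, hn⟩ + vvec n ⟨n - 1, by omega⟩) := by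
      ext i
      simp only [Pi.single_apply, Pi.smul_apply, Pi.add_apply, vvec, Fin.ext_iff, smul_eq_mul]
      split_ifs <;> first | omega | norm_num
    rw [this]
    exact Submodule.smul_mem _ _ (add_mem (hv _) (hv _))
  · have : Pi.single j (1 : ℝ) = (1 / 2 : ℝ) • (vvec n ⟨j - 1, by omega⟩ - vvec n j) := by
      ext i
      simp only [Pi.single_apply, Pi.smul_apply, Pi.sub_apply, vvec, Fin.ext_iff, smul_eq_mul]
      split_ifs <;> first | omega | norm_num
    rw [this]
    exact Submodule.smul_mem _ _ (sub_mem (hv _) (hv _))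

lemma exists_continuousLinearMap_vvec_eq {n : ℕ} (hn : 0 < n) {Y : Type*}
    [NormedAddCommGroup Y] [NormedSpace ℝ Y] (y : Fin n → Y) :
    ∃ T : (Fin n → ℝ) →L[ℝ] Y, (fun i => T (vvec n i)) = y := by
  let b := basisOfTopLeSpanOfCardEqFinrank (vvec n) (span_range_vvec hn).ge (by simp)
  refine ⟨LinearMap.toContinuousLinearMap (b.constr ℝ y), funext fun i => ?_⟩
  have hb : vvec n i = b i := by simp [b]
  rw [hb]
  simp

/-- `Φ(T) = (T v₁ⁿ, …, T vₙⁿ)` is a linear bijection from `L(ℓ∞ⁿ, Y)` onto `Yⁿ`,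
`‖T‖` is the maximum of `‖T(∑_j (−1)^{j+1} v_{i_j}ⁿ)‖` over tuples in `𝓘ₙ` (expressed as: it is
an upper bound and it is attained), and `Φ` maps the closed unit ball of `L(ℓ∞ⁿ, Y)` onto `M_Yⁿ`. -/
theorem stmt3 (n : ℕ) (hn : 0 < n) (Y : Type*) [NormedAddCommGroup Y] [NormedSpace ℝ Y]
    [CompleteSpace Y] :
    IsLinearMap ℝ (fun (T : (Fin n → ℝ) →L[ℝ] Y) => fun i => T (vvec n i)) ∧
    Function.Bijective (fun (T : (Fin n → ℝ) →L[ℝ] Y) => fun i => T (vvec n i)) ∧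
    (∀ T : (Fin n → ℝ) →L[ℝ] Y,
      (∀ k : ℕ, Odd k → k ≤ n → ∀ c : Fin k → Fin n, StrictMono c →
        ‖T (∑ j : Fin k, ((-1 : ℝ) ^ (j : ℕ)) • vvec n (c j))‖ ≤ ‖T‖) ∧
      (∃ k : ℕ, Odd k ∧ k ≤ n ∧ ∃ c : Fin k → Fin n, StrictMono c ∧
        ‖T (∑ j : Fin k, ((-1 : ℝ) ^ (j : ℕ)) • vvec n (c j))‖ = ‖T‖)) ∧
    (fun (T : (Fin n → ℝ) →L[ℝ] Y) => fun i => T (vvec n i)) '' Metric.closedBall 0 1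
      = MSet Y n := by
  have hub : ∀ T : (Fin n → ℝ) →L[ℝ] Y, ∀ k : ℕ, Odd k → k ≤ n → ∀ c : Fin k → Fin n,
      StrictMono c → ‖T (∑ j : Fin k, ((-1 : ℝ) ^ (j : ℕ)) • vvec n (c j))‖ ≤ ‖T‖ :=
    fun T k hk _ c hc => T.unit_le_opNorm _ (norm_alternating_sum_vvec_le_one hk hc)
  refine ⟨⟨fun _ _ => rfl, fun _ _ => rfl⟩,
    ⟨fun S T hST => ?_, exists_continuousLinearMap_vvec_eq hn⟩,
    fun T => ⟨hub T, exists_norm_alternating_sum_vvec_eq hn T⟩, Set.Subset.antisymm ?_ ?_⟩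
  · obtain ⟨k, -, -, c, -, h⟩ := exists_norm_alternating_sum_vvec_eq hn (S - T)
    have hST' : ∀ i, (S - T) (vvec n i) = 0 := fun i => sub_eq_zero.mpr (congrFun hST i)
    rw [← sub_eq_zero, ← norm_eq_zero, ← h]
    simp only [map_sum, map_smul, hST', smul_zero, Finset.sum_const_zero, norm_zero]
  · rintro _ ⟨T, hT, rfl⟩ k hk hkn c hc
    have := (hub T k hk hkn c hc).trans (mem_closedBall_zero_iff.mp hT)
    simpa only [map_sum, map_smul] using this
  · intro y hy
    obtain ⟨T, rfl⟩ := exists_continuousLinearMap_vvec_eq hn y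
    refine ⟨T, mem_closedBall_zero_iff.mpr ?_, rfl⟩
    obtain ⟨k, hk, hkn, c, hc, h⟩ := exists_norm_alternating_sum_vvec_eq hn T
    rw [← h]
    simpa only [map_sum, map_smul] using hy k hk hkn c hc
end
end

section
/- Let Y be a real Banach space and n a positive integer. Suppose there is a function ν : (0,1) → (0,1) with 0 < ν(ε) < ε such that for each (y₁,…,yₙ) ∈ M_Yⁿ and each convex combination ∑_{i=1}^{n} αᵢyᵢ with ‖∑_{i=1}^{n} αᵢyᵢ‖ > 1 − ν(ε) there exist C ⊆ {1,…,n} and (z₁,…,zₙ) ∈ M_Yⁿ with ∑_{i∈C} αᵢ > 1 − ε, ‖zᵢ − yᵢ‖ < ε for each i ≤ n, and ‖∑_{i∈C} zᵢ‖ = |C|. Then Y has the AHSp-ℓ∞ⁿ with the function γ(ε) = ν(ε/n). -/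
open scoped BigOperators

noncomputable section

theorem norm_le_one_of_mem_MSet {Y : Type*} [NormedAddCommGroup Y] [NormedSpace ℝ Y] {n : ℕ}
    {z : Fin n → Y} (hz : z ∈ MSet Y n) (i : Fin n) : ‖z i‖ ≤ 1 := by
  simpa using hz 1 odd_one (Nat.one_le_iff_ne_zero.mpr i.pos.ne') (fun _ => i)
    (Subsingleton.strictMono _)

theorem norm_sum_eq_card_of_subset {Y ι : Type*} [NormedAddCommGroup Y] {z : ι → Y}
    (hz : ∀ i, ‖z i‖ ≤ 1) {A C : Finset ι} (hAC : A ⊆ C) (hC : ‖∑ i ∈ C, z i‖ = (C.card : ℝ)) :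
    ‖∑ i ∈ A, z i‖ = (A.card : ℝ) := by
  classical
  have bound (S : Finset ι) : ‖∑ i ∈ S, z i‖ ≤ (S.card : ℝ) := by
    simpa using norm_sum_le_of_le S fun i _ => hz i
  have hcard : ((C \ A).card : ℝ) + A.card = C.card := by
    exact_mod_cast Finset.card_sdiff_add_card_eq_card hAC
  have htri := norm_add_le (∑ i ∈ C \ A, z i) (∑ i ∈ A, z i)
  rw [Finset.sum_sdiff hAC, hC] at htri
  linarith [bound (C \ A), bound A]

theorem subset_of_uniform_weight_gt {ι : Type*} [DecidableEq ι] {A C : Finset ι} {δ : ℝ}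
    (hA : A.Nonempty) (hδ : A.card * δ ≤ 1)
    (h : 1 - δ < ∑ i ∈ C, if i ∈ A then (A.card : ℝ)⁻¹ else 0) : A ⊆ C := by
  have hpos : (0 : ℝ) < A.card := by exact_mod_cast hA.card_pos
  rw [← Finset.sum_filter, Finset.filter_mem_eq_inter, Finset.sum_const, nsmul_eq_mul,
    ← div_eq_mul_inv, lt_div_iff₀ hpos] at h
  have hcard : A.card < (C ∩ A).card + 1 := by
    have : (A.card : ℝ) < (C ∩ A).card + 1 := by linarith
    exact_mod_cast this
  exact Finset.inter_eq_right.mp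
    (Finset.eq_of_subset_of_card_le Finset.inter_subset_right (by omega))

/-- if condition 4) of Proposition 2.6 holds with a function `ν`, then `Y` has the
AHSp-ℓ∞ⁿ with the function `γ(ε) = ν(ε/n)`. -/
theorem stmt7 (Y : Type*) [NormedAddCommGroup Y] [NormedSpace ℝ Y] [CompleteSpace Y]
    (n : ℕ) (hn : 0 < n) (ν : ℝ → ℝ)
    (hν : ∀ ε : ℝ, 0 < ε → ε < 1 → 0 < ν ε ∧ ν ε < ε)
    (h : ∀ ε : ℝ, 0 < ε → ε < 1 →
      ∀ y ∈ MSet Y n, ∀ α : Fin n → ℝ, (∀ i, 0 ≤ α i) → (∑ i, α i) = 1 →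
        1 - ν ε < ‖∑ i, α i • y i‖ →
          ∃ C : Finset (Fin n), ∃ z ∈ MSet Y n,
            (1 - ε < ∑ i ∈ C, α i) ∧ (∀ i, ‖z i - y i‖ < ε) ∧
            ‖∑ i ∈ C, z i‖ = (C.card : ℝ)) :
    AHSpWith Y n (fun ε => ν (ε / n)) := by
  classical
  intro ε hε hε1
  have hn1 : (1 : ℝ) ≤ n := by exact_mod_cast hn
  have hle : ε / n ≤ ε := div_le_self hε.le hn1
  have hδ : 0 < ε / n := by positivity
  have hδ1 : ε / n < 1 := hle.trans_lt hε1
  refine ⟨⟨(hν _ hδ hδ1).1, (hν _ hδ hδ1).2.trans_le hle⟩, ?_⟩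
  intro y hy A hA f hf hfA
  have hpos : (0 : ℝ) < A.card := by exact_mod_cast hA.card_pos
  have hcard : (A.card : ℝ) ≤ n := by
    exact_mod_cast (Finset.card_le_univ A).trans_eq (Fintype.card_fin n)
  let α : Fin n → ℝ := fun i => if i ∈ A then (A.card : ℝ)⁻¹ else 0
  have hα0 : ∀ i, 0 ≤ α i := fun i => by dsimp only [α]; split_ifs <;> positivity
  have hα1 : ∑ i, α i = 1 := by simp [α, hpos.ne']
  have hsum : f (∑ i, α i • y i) = (A.card : ℝ)⁻¹ * ∑ i ∈ A, f (y i) := by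
    simp [α, Finset.mul_sum]
  have hlt : A.card * (1 - ν (ε / n)) < ∑ i ∈ A, f (y i) := by
    simpa [mul_sub] using Finset.sum_lt_sum_of_nonempty hA hfA
  have hnorm : 1 - ν (ε / n) < ‖∑ i, α i • y i‖ := calc
    1 - ν (ε / n) < (A.card : ℝ)⁻¹ * ∑ i ∈ A, f (y i) := by rwa [lt_inv_mul_iff₀ hpos]
    _ = f (∑ i, α i • y i) := hsum.symm
    _ ≤ ‖f (∑ i, α i • y i)‖ := Real.le_norm_self _
    _ ≤ ‖∑ i, α i • y i‖ := by simpa [hf] using f.le_opNorm (∑ i, α i • y i)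
  obtain ⟨C, z, hz, hC, hzy, hzC⟩ := h _ hδ hδ1 y hy α hα0 hα1 hnorm
  have hAδ : A.card * (ε / n) ≤ 1 := calc
    A.card * (ε / n) ≤ n * (ε / n) := by gcongr
    _ = ε := by field_simp
    _ ≤ 1 := hε1.le
  exact ⟨z, hz, fun i => (hzy i).trans_le hle,
    norm_sum_eq_card_of_subset (norm_le_one_of_mem_MSet hz)
      (subset_of_uniform_weight_gt hA hAδ hC) hzC⟩
end
end

section
/- Let Y be a real Banach space, n a positive integer and B ⊆ S_{Y*} a 1-norming subset. Suppose there is a function ρ : (0,1) → (0,1) with 0 < ρ(ε) < ε such that for every (y₁,…,yₙ) ∈ M_Yⁿ, if there exist n₀ ≤ n and y* ∈ B with y*(yᵢ) > 1 − ρ(ε) for each i ≤ n₀, then there exists (z₁,…,zₙ) ∈ M_Yⁿ with ‖zᵢ − yᵢ‖ < ε for each i ≤ n and ‖∑_{i=1}^{n₀} zᵢ‖ = n₀. Then Y has the AHSp-ℓ∞ⁿ with the function γ(ε) = (1/4)·ρ(ε/n)². -/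
open scoped BigOperators

noncomputable section

/-- The inverse of the antiperiodic shift: `(y₀, …, yₘ) ↦ (-yₘ, y₀, …, yₘ₋₁)`. -/
def shiftRight {Y : Type*} [Neg Y] {m : ℕ} (y : Fin (m + 1) → Y) : Fin (m + 1) → Y :=
  Fin.cons (-y (Fin.last m)) (fun i => y i.castSucc)

/-- The antiperiodic shift: `(y₀, …, yₘ) ↦ (y₁, …, yₘ, -y₀)`. -/
def shiftLeft {Y : Type*} [Neg Y] {m : ℕ} (y : Fin (m + 1) → Y) : Fin (m + 1) → Y :=
  Fin.snoc (fun i => y i.succ) (-y 0)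

lemma shiftLeft_eq_rev {Y : Type*} [InvolutiveNeg Y] {m : ℕ} (y : Fin (m + 1) → Y) :
    shiftLeft y = shiftRight (y ∘ Fin.rev) ∘ Fin.rev := by
  ext i
  induction i using Fin.lastCases with
  | last => simp [shiftLeft, shiftRight]
  | cast i => simp [shiftLeft, shiftRight, Fin.rev_castSucc]

lemma norm_sum_eq_card_of_subset_s8 {Y : Type*} [NormedAddCommGroup Y] {ι : Type*}
    {z : ι → Y} (hz : ∀ i, ‖z i‖ ≤ 1)
    {s t : Finset ι} (hst : s ⊆ t) (ht : ‖∑ i ∈ t, z i‖ = (t.card : ℝ)) :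
    ‖∑ i ∈ s, z i‖ = (s.card : ℝ) := by
  classical
  have hle : ∀ u : Finset ι, ‖∑ i ∈ u, z i‖ ≤ u.card := fun u => by
    simpa using norm_sum_le_of_le u fun i _ => hz i
  refine le_antisymm (hle s) ?_
  have h1 := norm_add_le (∑ i ∈ t \ s, z i) (∑ i ∈ s, z i)
  rw [Finset.sum_sdiff hst, ht] at h1
  have h2 := hle (t \ s)
  have h3 : ((t \ s).card : ℝ) + s.card = t.card := by
    exact_mod_cast Finset.card_sdiff_add_card_eq_card hst
  linarith

section MSet

variable {Y : Type*} [NormedAddCommGroup Y] [NormedSpace ℝ Y]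

lemma neg_mem_MSet {n : ℕ} {y : Fin n → Y} (hy : y ∈ MSet Y n) : -y ∈ MSet Y n := by
  intro k hk hkn c hc
  simpa [Finset.sum_neg_distrib] using hy k hk hkn c hc

lemma norm_le_one_of_mem_MSet_s8 {n : ℕ} {y : Fin n → Y} (hy : y ∈ MSet Y n) (i : Fin n) :
    ‖y i‖ ≤ 1 := by
  have := hy 1 odd_one i.pos (fun _ => i) (Subsingleton.strictMono _)
  simpa using this

lemma norm_sub_add_le_one_of_mem_MSet {n : ℕ} {y : Fin n → Y} (hy : y ∈ MSet Y n)
    {i j k : Fin n} (hij : i < j) (hjk : j < k) : ‖y i - y j + y k‖ ≤ 1 := by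
  have hc : StrictMono ![i, j, k] := by
    rw [Fin.strictMono_iff_lt_succ]
    intro l
    fin_cases l
    · exact hij
    · exact hjk
  have := hy 3 (by decide) (by have := k.2; omega) ![i, j, k] hc
  simpa [Fin.sum_univ_three, sub_eq_add_neg] using this

lemma comp_rev_mem_MSet {n : ℕ} {y : Fin n → Y} (hy : y ∈ MSet Y n) :
    y ∘ Fin.rev ∈ MSet Y n := by
  intro k hk hkn c hc
  have hc' : StrictMono (fun j : Fin k => (c j.rev).rev) := fun i j hij =>
    Fin.rev_lt_rev.2 (hc (Fin.rev_lt_rev.2 hij))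
  have := hy k hk hkn _ hc'
  rw [← Equiv.sum_comp Fin.revPerm] at this
  convert this using 4 with j
  · rw [Fin.revPerm_apply, Fin.val_rev]
    have hj := j.2
    rcases Nat.even_or_odd (j : ℕ) with h | h
    · rw [h.neg_one_pow, Even.neg_one_pow]
      grind
    · rw [h.neg_one_pow, Odd.neg_one_pow]
      grind
  · simp

lemma shiftRight_mem_MSet {m : ℕ} {y : Fin (m + 1) → Y} (hy : y ∈ MSet Y (m + 1)) :
    shiftRight y ∈ MSet Y (m + 1) := by
  intro k hk hkn c hc
  obtain ⟨k, rfl⟩ : ∃ l, k = l + 1 := ⟨k - 1, by grind⟩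
  have hpos : ∀ j : Fin k, c j.succ ≠ 0 := fun j =>
    Fin.pos_iff_ne_zero.1 ((Fin.zero_le _).trans_lt (hc (Fin.succ_pos j)))
  have hshift : ∀ i (hi : i ≠ 0), shiftRight y i = y (i.pred hi).castSucc := by
    intro i hi
    obtain ⟨i, rfl⟩ := Fin.exists_succ_eq.2 hi
    simp [shiftRight]
  by_cases h0 : c 0 = 0
  · have hc' : StrictMono
        (Fin.snoc (fun j => ((c j.succ).pred (hpos j)).castSucc) (Fin.last m) :
          Fin (k + 1) → Fin (m + 1)) := by
      intro i j hij
      induction j using Fin.lastCases with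
      | last =>
        induction i using Fin.lastCases with
        | last => exact absurd hij (lt_irrefl _)
        | cast i => simp
      | cast j =>
        induction i using Fin.lastCases with
        | last => exact absurd hij (not_lt.2 (Fin.le_last _))
        | cast i =>
          simp only [Fin.snoc_castSucc, Fin.castSucc_lt_castSucc_iff, Fin.pred_lt_pred_iff]
          exact hc (Fin.succ_lt_succ_iff.2 (Fin.castSucc_lt_castSucc_iff.1 hij))
    have := hy (k + 1) hk hkn _ hc'
    have hk' : (-1 : ℝ) ^ k = 1 := Even.neg_one_pow (by grind)
    rw [Fin.sum_univ_castSucc] at this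
    rw [Fin.sum_univ_succ, ← norm_neg, h0]
    simp only [hshift _ (hpos _)]
    simp only [Fin.snoc_castSucc, Fin.snoc_last, Fin.val_castSucc, Fin.val_last, hk',
      one_smul] at this
    refine (congrArg norm ?_).trans_le this
    simp [shiftRight, pow_succ, add_comm]
  · have hne : ∀ j, c j ≠ 0 := fun j => by
      induction j using Fin.cases with
      | zero => exact h0
      | succ j => exact hpos j
    simp only [hshift _ (hne _)]
    refine hy (k + 1) hk hkn (fun j => ((c j).pred (hne j)).castSucc) fun i j hij => ?_
    simpa using hc hij

lemma shiftLeft_mem_MSet {m : ℕ} {y : Fin (m + 1) → Y} (hy : y ∈ MSet Y (m + 1)) :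
    shiftLeft y ∈ MSet Y (m + 1) := by
  rw [shiftLeft_eq_rev]
  exact comp_rev_mem_MSet (shiftRight_mem_MSet (comp_rev_mem_MSet hy))

/-- An approximation property for initial segments of indices passes to all intervals. -/
lemma exists_approx_interval {m n₀ : ℕ} {δ r : ℝ} (f : Y →L[ℝ] ℝ)
    (h : ∀ y ∈ MSet Y (m + 1), (∀ i : Fin (m + 1), (i : ℕ) < n₀ → 1 - r < f (y i)) →
      ∃ z ∈ MSet Y (m + 1), (∀ i, ‖z i - y i‖ < δ) ∧
        ‖∑ i ∈ Finset.univ.filter (fun i : Fin (m + 1) => (i : ℕ) < n₀), z i‖ = (n₀ : ℝ))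
    (a : ℕ) (ha : a + n₀ ≤ m + 1) (y : Fin (m + 1) → Y) (hy : y ∈ MSet Y (m + 1))
    (hf : ∀ i : Fin (m + 1), a ≤ (i : ℕ) → (i : ℕ) < a + n₀ → 1 - r < f (y i)) :
    ∃ z ∈ MSet Y (m + 1), (∀ i, ‖z i - y i‖ < δ) ∧
      ‖∑ i ∈ Finset.univ.filter (fun i : Fin (m + 1) => a ≤ (i : ℕ) ∧ (i : ℕ) < a + n₀), z i‖
        = (n₀ : ℝ) := by
  induction a generalizing y with
  | zero => simpa using h y hy (fun i hi => hf i (Nat.zero_le _) (by simpa using hi))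
  | succ a ih =>
    obtain ⟨w, hw, hwy, hsum⟩ := ih (by omega) (shiftLeft y) (shiftLeft_mem_MSet hy) (by
      intro i hi hi'
      induction i using Fin.lastCases with
      | last => simp at hi'; omega
      | cast i =>
        simp only [Fin.val_castSucc] at hi hi'
        simpa [shiftLeft] using hf i.succ (by simp; omega) (by simp; omega))
    refine ⟨shiftRight w, shiftRight_mem_MSet hw, fun i => ?_, ?_⟩
    · induction i using Fin.cases with
      | zero =>
        have := hwy (Fin.last m)
        rw [← norm_neg]
        simpa [shiftRight, shiftLeft, add_comm] using this
      | succ i => simpa [shiftRight, shiftLeft] using hwy i.castSucc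
    · rw [Finset.sum_filter, Fin.sum_univ_castSucc] at hsum
      rw [Finset.sum_filter, Fin.sum_univ_succ, ← hsum]
      have hlast : ¬ (a ≤ m ∧ m < a + n₀) := by omega
      simp only [Fin.val_castSucc, Fin.val_last, hlast, if_false, add_zero]
      simp [shiftRight, show ∀ x : ℕ, x + 1 < a + 1 + n₀ ↔ x < a + n₀ from fun x => by omega]

/-- A functional that is large on a sum of elements of the unit ball is large on each summand. -/
lemma lt_apply_of_lt_apply_sum {ι : Type*} {y : ι → Y} (hy : ∀ i, ‖y i‖ ≤ 1)
    {g : Y →L[ℝ] ℝ} (hg : ‖g‖ = 1) {s : Finset ι} {γ : ℝ}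
    (hs : (s.card : ℝ) * (1 - γ) < g (∑ i ∈ s, y i)) {i : ι} (hi : i ∈ s) :
    1 - s.card * γ < g (y i) := by
  classical
  have hle : ∀ j, g (y j) ≤ 1 := fun j => (le_abs_self _).trans <| by
    simpa [hg] using (g.le_opNorm (y j)).trans (by rw [hg, one_mul]; exact hy j)
  rw [map_sum, ← Finset.add_sum_erase s _ hi] at hs
  have h1 : ∑ j ∈ s.erase i, g (y j) ≤ (s.erase i).card := by
    simpa using Finset.sum_le_card_nsmul (s.erase i) (fun j => g (y j)) 1 fun j _ => hle j
  rw [Finset.cast_card_erase_of_mem hi] at h1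
  linarith

lemma IsOneNorming.exists_lt {B : Set (Y →L[ℝ] ℝ)} (hB : IsOneNorming B) {y : Y} {c : ℝ}
    (hc : 0 ≤ c) (h : c < ‖y‖) : ∃ g ∈ B, c < |g y| := by
  rw [hB.2 y] at h
  have hne : ((fun f : Y →L[ℝ] ℝ => |f y|) '' B).Nonempty := by
    by_contra hne
    rw [Set.not_nonempty_iff_eq_empty] at hne
    rw [hne, Real.sSup_empty] at h
    linarith
  obtain ⟨_, ⟨g, hg, rfl⟩, hlt⟩ := exists_lt_of_lt_csSup hne h
  exact ⟨g, hg, hlt⟩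

end MSet

/-- if condition 3) of Proposition 2.6 holds for a 1-norming set `B` with a
function `ρ`, then `Y` has the AHSp-ℓ∞ⁿ with the function `γ(ε) = (1/4)·ρ(ε/n)²`. -/
theorem stmt8 (Y : Type*) [NormedAddCommGroup Y] [NormedSpace ℝ Y] [CompleteSpace Y]
    (n : ℕ) (hn : 0 < n) (B : Set (Y →L[ℝ] ℝ)) (hB : IsOneNorming B)
    (ρ : ℝ → ℝ) (hρ : ∀ ε : ℝ, 0 < ε → ε < 1 → 0 < ρ ε ∧ ρ ε < ε)
    (h : ∀ ε : ℝ, 0 < ε → ε < 1 →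
      ∀ y ∈ MSet Y n, ∀ n₀ : ℕ, 1 ≤ n₀ → n₀ ≤ n →
        ∀ f ∈ B, (∀ i : Fin n, (i : ℕ) < n₀ → 1 - ρ ε < f (y i)) →
          ∃ z ∈ MSet Y n, (∀ i, ‖z i - y i‖ < ε) ∧
            ‖∑ i ∈ Finset.univ.filter (fun i : Fin n => (i : ℕ) < n₀), z i‖ = (n₀ : ℝ)) :
    AHSpWith Y n (fun ε => (1 / 4) * (ρ (ε / n)) ^ 2) := by
  intro ε hε hε1
  have hn' : (1 : ℝ) ≤ n := by exact_mod_cast hn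
  have hδ : 0 < ε / n := by positivity
  have hδε : ε / n ≤ ε := div_le_self hε.le hn'
  obtain ⟨hr, hrδ⟩ := hρ (ε / n) hδ (by linarith)
  replace h := h (ε / n) hδ (by linarith)
  beta_reduce
  have hnr : n * ρ (ε / n) < 1 := by
    have := (lt_div_iff₀ (by linarith : (0 : ℝ) < n)).1 hrδ
    linarith
  generalize ρ (ε / n) = r at *
  have hγr : n * (2 * (1 / 4 * r ^ 2)) ≤ r := by nlinarith
  have hγ : 0 < 1 / 4 * r ^ 2 := by positivity
  refine ⟨⟨hγ, by nlinarith⟩, ?_⟩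
  generalize 1 / 4 * r ^ 2 = γ at *
  intro y hy A hA f hf hfA
  obtain ⟨m, rfl⟩ : ∃ m, n = m + 1 := ⟨n - 1, by omega⟩
  have hcard : (A.card : ℝ) ≤ (m + 1 : ℕ) := by
    exact_mod_cast (Finset.card_le_univ A).trans_eq (Fintype.card_fin _)
  have hsum : (A.card : ℝ) * (1 - γ) < ‖∑ i ∈ A, y i‖ := by
    have h1 : ∑ _i ∈ A, (1 - γ) < ∑ i ∈ A, f (y i) := Finset.sum_lt_sum_of_nonempty hA hfA
    rw [Finset.sum_const, nsmul_eq_mul, ← map_sum] at h1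
    have h2 := f.le_opNorm (∑ i ∈ A, y i)
    rw [hf, one_mul] at h2
    exact h1.trans_le ((le_abs_self _).trans h2)
  have hγ1 : γ ≤ 1 := by nlinarith
  obtain ⟨g, hgB, hg⟩ := hB.exists_lt (mul_nonneg (Nat.cast_nonneg _) (by linarith)) hsum
  have key : ∀ y ∈ MSet Y (m + 1), (A.card : ℝ) * (1 - γ) < g (∑ i ∈ A, y i) →
      ∃ z ∈ MSet Y (m + 1), (∀ i, ‖z i - y i‖ < ε) ∧ ‖∑ i ∈ A, z i‖ = (A.card : ℝ) := by
    intro y hy hgy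
    have hgA : ∀ i ∈ A, 1 - (m + 1 : ℕ) * γ < g (y i) := fun i hi => by
      have := lt_apply_of_lt_apply_sum (norm_le_one_of_mem_MSet_s8 hy) (hB.1 g hgB) hgy hi
      nlinarith
    have hmin := A.min'_mem hA
    have hmax := A.max'_mem hA
    have hle : A.min' hA ≤ A.max' hA := A.min'_le_max' hA
    set a := A.min' hA
    set b := A.max' hA
    have hgI : ∀ i, a ≤ i → i ≤ b → 1 - r < g (y i) := by
      intro i hai hib
      have ha := hgA a hmin
      have hb := hgA b hmax
      have hpos : 0 ≤ (m + 1 : ℕ) * γ := by positivity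
      rcases hai.eq_or_lt with rfl | hai
      · linarith
      rcases hib.eq_or_lt with rfl | hib
      · linarith
      have h1 := g.le_opNorm (y a - y i + y b)
      rw [hB.1 g hgB, one_mul] at h1
      have h2 := (le_abs_self _).trans (h1.trans (norm_sub_add_le_one_of_mem_MSet hy hai hib))
      rw [map_add, map_sub] at h2
      linarith
    have hle' : (a : ℕ) ≤ b := hle
    have hb' := b.2
    obtain ⟨z, hz, hzy, hzs⟩ := exists_approx_interval (n₀ := b - a + 1) g
      (fun y hy => h y hy (b - a + 1) (by omega) (by omega) g hgB) a (by omega) y hy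
      (fun i hi hi' => hgI i (Fin.le_def.2 hi) (Fin.le_def.2 (by omega)))
    have hI : Finset.univ.filter
        (fun i : Fin (m + 1) => (a : ℕ) ≤ i ∧ (i : ℕ) < a + (b - a + 1)) = Finset.Icc a b := by
      ext i
      simp only [Finset.mem_filter, Finset.mem_univ, true_and, Finset.mem_Icc, Fin.le_def]
      omega
    refine ⟨z, hz, fun i => (hzy i).trans_le hδε,
      norm_sum_eq_card_of_subset_s8 (norm_le_one_of_mem_MSet_s8 hz) (t := Finset.Icc a b)
        (fun i hi => Finset.mem_Icc.2 ⟨A.min'_le i hi, A.le_max' i hi⟩) ?_⟩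
    rw [← hI, hzs, hI, Fin.card_Icc, show (b : ℕ) + 1 - a = b - a + 1 by omega]
  rcases lt_abs.1 hg with hg | hg
  · exact key y hy hg
  · obtain ⟨z, hz, hzy, hzs⟩ := key (-y) (neg_mem_MSet hy) (by simpa using hg)
    refine ⟨-z, neg_mem_MSet hz, fun i => ?_, by simpa using hzs⟩
    rw [← norm_neg]
    simpa [add_comm] using hzy i
end
end

section
/- Let 0 < ε < 1, n a positive integer, Y a real Banach space, S ∈ L(ℓ∞ⁿ, Y) with ‖S‖ = 1, x ∈ co(𝓑ₙ) and y ∈ S_{ℓ∞ⁿ} such that ‖S(y)‖ = 1 and ‖y − x‖ < ε. Then there exists z ∈ co(𝓑ₙ) such that ‖S(z)‖ = 1 and ‖z − x‖ < ε. -/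
open scoped BigOperators

noncomputable section

/-- The convex hull of the vectors `vvec n i` is contained in the set of functions equal to `1` at
the first index, with values in `[-1, 1]`, and monotone on the remaining indices. -/
lemma convexHull_vvec_subset (n : ℕ) :
    convexHull ℝ (Set.range (vvec n)) ⊆
      {x | (∀ j : Fin n, (j : ℕ) = 0 → x j = 1) ∧ (∀ j, -1 ≤ x j ∧ x j ≤ 1) ∧
        ∀ i j : Fin n, 0 < (i : ℕ) → i ≤ j → x i ≤ x j} := by
  apply convexHull_min
  · rintro _ ⟨i, rfl⟩
    refine ⟨fun j hj => by simp [vvec, hj], fun j => ?_, fun a b ha hab => ?_⟩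
    · unfold vvec
      split_ifs <;> norm_num
    · have hab' : (a : ℕ) ≤ b := hab
      unfold vvec
      split_ifs <;> first | omega | norm_num
  · rintro x ⟨hx0, hx1, hx2⟩ y ⟨hy0, hy1, hy2⟩ a b ha hb hab
    simp only [Set.mem_ofPred_eq, Pi.add_apply, Pi.smul_apply, smul_eq_mul]
    refine ⟨fun j hj => by rw [hx0 j hj, hy0 j hj]; linarith, fun j => ⟨?_, ?_⟩,
      fun i j hi hij => ?_⟩
    · nlinarith [hx1 j, hy1 j]
    · nlinarith [hx1 j, hy1 j]
    · exact add_le_add (mul_le_mul_of_nonneg_left (hx2 i j hi hij) ha)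
        (mul_le_mul_of_nonneg_left (hy2 i j hi hij) hb)

lemma sum_range_half_sub_mul_sign (u : ℕ → ℝ) (j m : ℕ) :
    ∑ i ∈ Finset.range m, (u (i + 1) - u i) / 2 * (if j ≤ i then -1 else 1) =
      if m ≤ j then (u m - u 0) / 2 else u j - (u m + u 0) / 2 := by
  induction m with
  | zero => simp
  | succ m ih =>
    rw [Finset.sum_range_succ, ih]
    rcases lt_trichotomy j m with h | h | h
    · rw [if_neg (by omega), if_pos h.le, if_neg (by omega)]; ring
    · subst h
      rw [if_pos le_rfl, if_pos le_rfl, if_neg (by omega)]; ring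
    · rw [if_pos h.le, if_neg (by omega), if_pos (by omega)]; ring

/-- A function equal to `1` at the first index, with values in `[-1, 1]`, and monotone on the
remaining indices lies in the convex hull of the vectors `vvec n i`. -/
lemma mem_convexHull_vvec {n : ℕ} (hn : 0 < n) {z : Fin n → ℝ}
    (h0 : ∀ j : Fin n, (j : ℕ) = 0 → z j = 1) (h1 : ∀ j, -1 ≤ z j ∧ z j ≤ 1)
    (h2 : ∀ i j : Fin n, 0 < (i : ℕ) → i ≤ j → z i ≤ z j) :
    z ∈ convexHull ℝ (Set.range (vvec n)) := by
  set u : ℕ → ℝ := fun k => if k = 0 then -1 else if h : k < n then z ⟨k, h⟩ else 1 with hu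
  have u0 : u 0 = -1 := by simp [hu]
  have un : u n = 1 := by simp [hu, hn.ne']
  have umono : Monotone u := by
    refine monotone_nat_of_le_succ fun k => ?_
    simp only [hu, Nat.succ_ne_zero, if_false]
    rcases Nat.eq_zero_or_pos k with rfl | hk
    · rw [if_pos rfl]
      split_ifs
      · exact (h1 _).1
      · norm_num
    · rw [if_neg hk.ne']
      rcases lt_or_ge (k + 1) n with h | h
      · rw [dif_pos h, dif_pos (by omega)]
        exact h2 _ _ hk (Nat.le_succ k)
      · rw [dif_neg h.not_gt]
        split_ifs
        · exact (h1 _).2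
        · exact le_rfl
  have hz : z = ∑ i : Fin n, ((u (i + 1) - u i) / 2) • vvec n i := by
    funext j
    simp only [Finset.sum_apply, Pi.smul_apply, smul_eq_mul, vvec]
    by_cases hj : (j : ℕ) = 0
    · have h := Finset.sum_range_sub u n
      rw [← Fin.sum_univ_eq_sum_range (fun i => u (i + 1) - u i)] at h
      simp only [hj, lt_self_iff_false, false_and, if_false, mul_one]
      rw [← Finset.sum_div, h, h0 j hj, u0, un]
      norm_num
    · have h := sum_range_half_sub_mul_sign u j n
      rw [← Fin.sum_univ_eq_sum_range
        (fun i => (u (i + 1) - u i) / 2 * (if (j : ℕ) ≤ i then (-1 : ℝ) else 1))] at h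
      simp only [Nat.pos_of_ne_zero hj, true_and]
      rw [h, if_neg (by omega), u0, un]
      simp [hu, hj]
  rw [hz]
  refine (convex_convexHull ℝ _).sum_mem (fun i _ => ?_) ?_
    fun i _ => subset_convexHull ℝ _ ⟨i, rfl⟩
  · linarith [umono (Nat.le_succ (i : ℕ))]
  · rw [Fin.sum_univ_eq_sum_range (fun i => (u (i + 1) - u i) / 2), ← Finset.sum_div,
      Finset.sum_range_sub, u0, un]
    norm_num

/-- If a norm-one operator on `ℓ∞ⁿ` attains its norm at `y`, then it attains its norm at every `z`
in the unit ball which agrees with `y` on the coordinates where `|y j| = 1`. -/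
lemma norm_apply_eq_one_of_eq_on_extremal {n : ℕ} {Y : Type*} [NormedAddCommGroup Y]
    [NormedSpace ℝ Y] {S : (Fin n → ℝ) →L[ℝ] Y} (hS : ‖S‖ = 1) {y z : Fin n → ℝ}
    (hy : ‖y‖ ≤ 1) (hz : ‖z‖ ≤ 1) (hSy : ‖S y‖ = 1) (h : ∀ j, |y j| = 1 → z j = y j) :
    ‖S z‖ = 1 := by
  have hball : ∀ w, ‖w‖ ≤ 1 → ‖S w‖ ≤ 1 := fun w hw => by
    simpa using S.le_of_opNorm_le_of_le hS.le hw
  obtain ⟨t, ht, ht0⟩ : ∃ t : ℝ, (∀ j, |y j + t * (y j - z j)| ≤ 1) ∧ 0 < t := by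
    have hev : ∀ᶠ t in nhdsWithin (0 : ℝ) (Set.Ioi 0), ∀ j, |y j + t * (y j - z j)| ≤ 1 := by
      refine Filter.eventually_all.2 fun j => ?_
      have hyj : |y j| ≤ 1 := (norm_le_pi_norm y j).trans hy
      rcases hyj.eq_or_lt with hj | hj
      · simp [h j hj, hj]
      · have hc : Continuous fun t : ℝ => |y j + t * (y j - z j)| := by fun_prop
        have hlt := hc.continuousAt.eventually_lt (x₀ := 0) (continuousAt_const (y := (1 : ℝ)))
          (by simpa using hj)
        exact (hlt.filter_mono nhdsWithin_le_nhds).mono fun t ht => ht.le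
    exact (hev.and self_mem_nhdsWithin).exists
  have hw : ‖S (y + t • (y - z))‖ ≤ 1 :=
    hball _ ((pi_norm_le_iff_of_nonneg zero_le_one).2 fun j => by simpa using ht j)
  have hsplit : (1 + t) • S y = S (y + t • (y - z)) + t • S z := by
    simp only [map_add, map_smul, map_sub]
    module
  have hle : 1 + t ≤ 1 + t * ‖S z‖ := by
    calc 1 + t = ‖(1 + t) • S y‖ := by
          rw [norm_smul, hSy, Real.norm_of_nonneg (by linarith), mul_one]
      _ ≤ ‖S (y + t • (y - z))‖ + ‖t • S z‖ := hsplit ▸ norm_add_le _ _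
      _ ≤ 1 + t * ‖S z‖ := by
          rw [norm_smul, Real.norm_of_nonneg ht0.le]
          linarith
  exact le_antisymm (hball z hz) (by nlinarith)

/-- Lemma 3.1: if a norm-one operator `S ∈ L(ℓ∞ⁿ, Y)` attains its norm at
`y ∈ S_{ℓ∞ⁿ}` with `‖y − x‖ < ε` for some `x ∈ co(𝓑ₙ)`, then `S` attains its norm at some
`z ∈ co(𝓑ₙ)` with `‖z − x‖ < ε`. -/
theorem stmt12 (ε : ℝ) (hε0 : 0 < ε) (hε1 : ε < 1) (n : ℕ) (hn : 0 < n)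
    (Y : Type*) [NormedAddCommGroup Y] [NormedSpace ℝ Y] [CompleteSpace Y]
    (S : (Fin n → ℝ) →L[ℝ] Y) (hS : ‖S‖ = 1)
    (x : Fin n → ℝ) (hx : x ∈ convexHull ℝ (Set.range (vvec n)))
    (y : Fin n → ℝ) (hy : ‖y‖ = 1) (hSy : ‖S y‖ = 1) (hyx : ‖y - x‖ < ε) :
    ∃ z ∈ convexHull ℝ (Set.range (vvec n)), ‖S z‖ = 1 ∧ ‖z - x‖ < ε := by
  obtain ⟨hx0, hx1, hx2⟩ := convexHull_vvec_subset n hx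
  set φ : ℝ → ℝ := fun s => if s < -1 + ε then -1 else if 1 - ε < s then 1 else s with hφ
  have hφ1 : φ 1 = 1 := by
    simp only [hφ]
    rw [if_neg (by linarith), if_pos (by linarith)]
  have hφbd : ∀ s, -1 ≤ s → s ≤ 1 → -1 ≤ φ s ∧ φ s ≤ 1 := fun s h₁ h₂ => by
    simp only [hφ]
    split_ifs <;> constructor <;> linarith
  have hφmono : Monotone φ := fun s t hst => by
    simp only [hφ]
    split_ifs <;> linarith
  have hφdist : ∀ s, -1 ≤ s → s ≤ 1 → |φ s - s| < ε := fun s h₁ h₂ => by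
    simp only [hφ]
    split_ifs <;> rw [abs_lt] <;> constructor <;> linarith
  have hz1 : ∀ j, -1 ≤ φ (x j) ∧ φ (x j) ≤ 1 := fun j => hφbd _ (hx1 j).1 (hx1 j).2
  refine ⟨fun j => φ (x j), mem_convexHull_vvec hn (fun j hj => by rw [hx0 j hj, hφ1]) hz1
    (fun i j hi hij => hφmono (hx2 i j hi hij)),
    norm_apply_eq_one_of_eq_on_extremal hS hy.le
      ((pi_norm_le_iff_of_nonneg zero_le_one).2 fun j => abs_le.2 (hz1 j)) hSy fun j hj => ?_,
    (pi_norm_lt_iff hε0).2 fun j => hφdist _ (hx1 j).1 (hx1 j).2⟩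
  have hd := abs_lt.1 ((pi_norm_lt_iff hε0).1 hyx j)
  rw [Pi.sub_apply] at hd
  simp only [hφ]
  rcases eq_or_eq_neg_of_abs_eq hj with h | h <;> rw [h] at hd ⊢
  · rw [if_neg (by linarith), if_pos (by linarith)]
  · rw [if_pos (by linarith)]
end
end

section
/- Let Y be a real Banach space and n a positive integer. If the pair (ℓ∞ⁿ, Y) has the Bishop–Phelps–Bollobás property for operators with function η : (0,1) → (0,1), then Y has the approximate hyperplane sum property for ℓ∞ⁿ with the function γ(ε) = η(ε/(n(n+1))). -/
open scoped BigOperators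

noncomputable section

/-- The alternating sum of an antitone sequence of odd length lies between its last and
first terms. -/
theorem antitone_alternating_sum_mem_Icc (p : ℕ) (a : Fin (2 * p + 1) → ℝ) (ha : Antitone a) :
    ∑ j : Fin (2 * p + 1), (-1 : ℝ) ^ (j : ℕ) * a j ∈ Set.Icc (a (Fin.last _)) (a 0) := by
  induction p with
  | zero => simp
  | succ p ih =>
    obtain ⟨h₁, h₂⟩ := ih (fun j => a j.castSucc.castSucc)
      (fun i j hij => ha (by simpa using hij))
    have h₃ : a (Fin.last (2 * p + 1)).castSucc ≤ a (Fin.last (2 * p)).castSucc.castSucc :=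
      ha (Fin.castSucc_le_castSucc_iff.2 (Fin.le_last _))
    have h₄ : a (Fin.last (2 * p + 2)) ≤ a (Fin.last (2 * p + 1)).castSucc := ha (Fin.le_last _)
    have h₅ : ∑ j : Fin (2 * (p + 1) + 1), (-1 : ℝ) ^ (j : ℕ) * a j =
        ∑ j : Fin (2 * p + 1), (-1 : ℝ) ^ (j : ℕ) * a j.castSucc.castSucc
          - a (Fin.last (2 * p + 1)).castSucc + a (Fin.last (2 * p + 2)) := by
      change ∑ j : Fin (2 * p + 1 + 1 + 1), (-1 : ℝ) ^ (j : ℕ) * a j = _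
      rw [Fin.sum_univ_castSucc, Fin.sum_univ_castSucc]
      simp [pow_succ, pow_mul, sub_eq_add_neg]
    rw [h₅]
    constructor
    · change a (Fin.last (2 * p + 2)) ≤ _
      linarith
    · change _ ≤ a (Fin.castSucc (Fin.castSucc (0 : Fin (2 * p + 1))))
      linarith

theorem vvec_eq_one_or (n : ℕ) (i j : Fin n) : vvec n i j = 1 ∨ vvec n i j = -1 := by
  unfold vvec
  split_ifs <;> simp

theorem norm_vvec_apply (n : ℕ) (i j : Fin n) : ‖vvec n i j‖ = 1 := by
  rcases vvec_eq_one_or n i j with h | h <;> simp [h]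

theorem antitone_vvec_apply (n : ℕ) (m : Fin n) : Antitone fun i => vvec n i m := by
  intro i j hij
  have hij' : (i : ℕ) ≤ j := hij
  simp only [vvec]
  split_ifs <;> first | omega | norm_num

/-- Contractions map the tuple `vvec n` into `MSet Y n`. -/
theorem apply_vvec_mem_MSet {Y : Type*} [NormedAddCommGroup Y] [NormedSpace ℝ Y] {n : ℕ}
    (S : (Fin n → ℝ) →L[ℝ] Y) (hS : ‖S‖ ≤ 1) : (fun i => S (vvec n i)) ∈ MSet Y n := by
  rintro k ⟨p, rfl⟩ - c hc
  have h : ∑ j : Fin (2 * p + 1), (-1 : ℝ) ^ (j : ℕ) • S (vvec n (c j)) =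
      S (∑ j : Fin (2 * p + 1), (-1 : ℝ) ^ (j : ℕ) • vvec n (c j)) := by simp
  rw [h]
  refine (S.le_of_opNorm_le_of_le (b := 1) hS ?_).trans (by norm_num)
  refine (pi_norm_le_iff_of_nonneg zero_le_one).2 fun m => ?_
  have hm := antitone_alternating_sum_mem_Icc p (fun j => vvec n (c j) m)
    ((antitone_vvec_apply n m).comp_monotone hc.monotone)
  have bound : ∀ i, |vvec n i m| ≤ 1 := fun i => (norm_vvec_apply n i m).le
  simp only [Finset.sum_apply, Pi.smul_apply, smul_eq_mul, Real.norm_eq_abs]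
  exact abs_le.2 ⟨(abs_le.1 (bound _)).1.trans hm.1, hm.2.trans (abs_le.1 (bound _)).2⟩

/-- Summing `y` against half the increments of a sequence of signs starting at `-1` gives an
alternating sum, whose length has the parity prescribed by the last sign. -/
theorem exists_alternating_sum {Y : Type*} [AddCommGroup Y] [Module ℝ Y] (w : ℕ → ℝ)
    (hw : ∀ i, w i = 1 ∨ w i = -1) (h0 : w 0 = -1) (y : ℕ → Y) (q : ℕ) :
    ∃ (k : ℕ) (c : Fin k → ℕ), StrictMono c ∧ (∀ j, c j < q) ∧ (-1 : ℝ) ^ k = -w q ∧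
      ∑ i ∈ Finset.range q, ((w (i + 1) - w i) / 2) • y i =
        ∑ j : Fin k, (-1 : ℝ) ^ (j : ℕ) • y (c j) := by
  induction q with
  | zero => exact ⟨0, Fin.elim0, fun i => i.elim0, fun i => i.elim0, by simp [h0], by simp⟩
  | succ q ih =>
    obtain ⟨k, c, hc, hcq, hk, hsum⟩ := ih
    by_cases heq : w (q + 1) = w q
    · exact ⟨k, c, hc, fun j => (hcq j).trans q.lt_succ_self, by rw [hk, heq],
        by simp [Finset.sum_range_succ, hsum, heq]⟩
    · have hneg : w (q + 1) = -w q := by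
        rcases hw q with h | h <;> rcases hw (q + 1) with h' | h' <;> simp_all
      refine ⟨k + 1, Fin.snoc c q, ?_, ?_, by rw [pow_succ, hk, hneg]; ring, ?_⟩
      · intro i j hij
        induction j using Fin.lastCases with
        | last =>
          induction i using Fin.lastCases with
          | last => exact absurd hij (lt_irrefl _)
          | cast i => simpa using hcq i
        | cast j =>
          induction i using Fin.lastCases with
          | last => exact absurd hij (Fin.le_last _).not_gt
          | cast i => simpa using hc (Fin.castSucc_lt_castSucc_iff.1 hij)
      · intro j
        induction j using Fin.lastCases with
        | last => simp
        | cast j => simpa using (hcq j).trans q.lt_succ_self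
      · rw [Finset.sum_range_succ, hsum, Fin.sum_univ_castSucc]
        simp only [Fin.snoc_castSucc, Fin.snoc_last, Fin.val_castSucc, Fin.val_last, hk, hneg]
        congr 2
        ring

/-- The values `-x 0, x 1, …, x (n - 1), x 0, x 0, …`. -/
def twistedExtension (n : ℕ) (hn : 0 < n) (x : Fin n → ℝ) (j : ℕ) : ℝ :=
  if j = 0 then -x ⟨0, hn⟩ else if h : j < n then x ⟨j, h⟩ else x ⟨0, hn⟩

/-- The linear map sending `vvec n i` to `y i` for every `i`. -/
def vvecLift {Y : Type*} [AddCommGroup Y] [Module ℝ Y] (n : ℕ) (hn : 0 < n)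
    (y : Fin n → Y) : (Fin n → ℝ) →ₗ[ℝ] Y where
  toFun x := ∑ i : Fin n,
    ((twistedExtension n hn x (i + 1) - twistedExtension n hn x i) / 2) • y i
  map_add' x x' := by
    rw [← Finset.sum_add_distrib]
    refine Finset.sum_congr rfl fun i _ => ?_
    rw [← add_smul]
    congr 1
    simp only [twistedExtension, Pi.add_apply]
    split_ifs <;> ring
  map_smul' r x := by
    rw [Finset.smul_sum]
    refine Finset.sum_congr rfl fun i _ => ?_
    rw [smul_smul]
    congr 1
    simp only [twistedExtension, Pi.smul_apply, smul_eq_mul, RingHom.id_apply]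
    split_ifs <;> ring

theorem vvecLift_vvec {Y : Type*} [AddCommGroup Y] [Module ℝ Y] (n : ℕ) (hn : 0 < n)
    (y : Fin n → Y) (i : Fin n) : vvecLift n hn y (vvec n i) = y i := by
  have hw : ∀ j, twistedExtension n hn (vvec n i) j = if j ≤ (i : ℕ) then -1 else 1 := by
    intro j
    have := i.isLt
    simp only [twistedExtension, vvec]
    split_ifs <;> first | rfl | omega
  change ∑ j : Fin n, _ = _
  rw [Finset.sum_eq_single i]
  · simp only [hw]
    norm_num
  · intro j _ hj
    have hj' : (j : ℕ) ≠ i := fun h => hj (Fin.ext h)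
    simp only [hw]
    split_ifs <;> first | omega | simp
  · simp

theorem norm_vvecLift_sign_le {Y : Type*} [NormedAddCommGroup Y] [NormedSpace ℝ Y] {n : ℕ}
    (hn : 0 < n) {y : Fin n → Y} (hy : y ∈ MSet Y n) (s : Fin n → ℝ)
    (hs : ∀ m, s m = 1 ∨ s m = -1) : ‖vvecLift n hn y s‖ ≤ 1 := by
  wlog h0 : s ⟨0, hn⟩ = 1 generalizing s
  · have h0' : s ⟨0, hn⟩ = -1 := (hs _).resolve_left h0
    simpa using this (-s) (fun m => by rcases hs m with h | h <;> simp [h]) (by simp [h0'])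
  let y' : ℕ → Y := fun j => if h : j < n then y ⟨j, h⟩ else 0
  obtain ⟨k, c, hc, hcn, hk, hsum⟩ := exists_alternating_sum (twistedExtension n hn s)
    (fun j => by
      simp only [twistedExtension]
      split_ifs
      · simp [h0]
      · exact hs _
      · exact hs _)
    (by simp [twistedExtension, h0]) y' n
  have hlift : vvecLift n hn y s = ∑ j : Fin k, (-1 : ℝ) ^ (j : ℕ) • y' (c j) := by
    rw [← hsum, Finset.sum_range]
    simp [vvecLift, y']
  have hodd : Odd k := by
    have hlast : twistedExtension n hn s n = 1 := by simp [twistedExtension, hn.ne', h0]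
    rw [hlast] at hk
    by_contra hcon
    rw [Nat.not_odd_iff_even] at hcon
    rw [hcon.neg_one_pow] at hk
    norm_num at hk
  have hc' : StrictMono fun j => (⟨c j, hcn j⟩ : Fin n) := fun i j hij => hc hij
  have hkn : k ≤ n := by simpa using Fintype.card_le_of_injective _ hc'.injective
  have hbound := hy k hodd hkn _ hc'
  rw [hlift]
  simpa [y', hcn] using hbound

theorem norm_vvecLift_le {Y : Type*} [NormedAddCommGroup Y] [NormedSpace ℝ Y] {n : ℕ}
    (hn : 0 < n) {y : Fin n → Y} (hy : y ∈ MSet Y n) :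
    ‖LinearMap.toContinuousLinearMap (vvecLift n hn y)‖ ≤ 1 := by
  refine ContinuousLinearMap.opNorm_le_of_unit_norm zero_le_one fun x hx => ?_
  rw [LinearMap.coe_toContinuousLinearMap']
  obtain ⟨f, hf, hfx⟩ := exists_dual_vector'' ℝ (vvecLift n hn y x)
  let g : (Fin n → ℝ) →ₗ[ℝ] ℝ := (f : Y →ₗ[ℝ] ℝ).comp (vvecLift n hn y)
  let b : Fin n → ℝ := fun m => g fun j => if m = j then 1 else 0
  let s : Fin n → ℝ := fun m => if 0 ≤ b m then 1 else -1
  have hs : ∀ m, s m = 1 ∨ s m = -1 := fun m => by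
    simp only [s]
    split_ifs <;> simp
  have hg : g x ≤ g s := by
    rw [g.pi_apply_eq_sum_univ x, g.pi_apply_eq_sum_univ s]
    refine Finset.sum_le_sum fun m _ => ?_
    have hxm : |x m| ≤ 1 := (norm_le_pi_norm x m).trans hx.le
    change x m * b m ≤ s m * b m
    obtain ⟨h₁, h₂⟩ := abs_le.1 hxm
    simp only [s]
    split_ifs with h <;> nlinarith
  calc ‖vvecLift n hn y x‖ = g x := hfx.symm
    _ ≤ g s := hg
    _ ≤ ‖f (vvecLift n hn y s)‖ := le_abs_self _
    _ ≤ 1 * 1 := f.le_of_opNorm_le_of_le hf (norm_vvecLift_sign_le hn hy s hs)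
    _ = 1 := one_mul 1

/-- If `u = t • v + w` with `‖w‖ ≤ 1 - t`, a functional in the dual unit ball with value `1` at
`u` is at least `1` at `v`. -/
theorem one_le_apply_of_norm_sub_smul_le {X : Type*} [NormedAddCommGroup X] [NormedSpace ℝ X]
    {g : X →L[ℝ] ℝ} (hg : ‖g‖ ≤ 1) {u v : X} {t : ℝ} (ht : 0 < t) (hu : g u = 1)
    (huv : ‖u - t • v‖ ≤ 1 - t) : 1 ≤ g v := by
  have h := (le_abs_self _).trans (g.le_of_opNorm_le_of_le hg huv)
  rw [map_sub, map_smul, hu, smul_eq_mul] at h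
  nlinarith

theorem norm_avg_vvec {n : ℕ} (hn : 0 < n) {A : Finset (Fin n)} (hA : A.Nonempty) :
    ‖(A.card : ℝ)⁻¹ • ∑ i ∈ A, vvec n i‖ = 1 := by
  have hcard : (0 : ℝ) < A.card := by exact_mod_cast hA.card_pos
  refine le_antisymm ?_ ?_
  · rw [norm_smul, norm_inv, Real.norm_natCast, inv_mul_le_iff₀ hcard, mul_one]
    have hle : ∀ i ∈ A, ‖vvec n i‖ ≤ 1 := fun i _ =>
      (pi_norm_le_iff_of_nonneg zero_le_one).2 fun j => (norm_vvec_apply n i j).le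
    simpa using norm_sum_le_of_le A hle
  · refine le_trans ?_ (norm_le_pi_norm _ (⟨0, hn⟩ : Fin n))
    simp [vvec, hcard.ne']

/-- A unit vector close to the average of `vvec n i`, `i ∈ A`, leaves room for a multiple of
each of these vectors. -/
theorem norm_sub_smul_vvec_le {n : ℕ} {A : Finset (Fin n)} {i : Fin n} (hi : i ∈ A)
    {u : Fin n → ℝ} (hu : ‖u‖ ≤ 1) {t : ℝ} (ht : t ≤ 1)
    (hclose : ‖u - (A.card : ℝ)⁻¹ • ∑ j ∈ A, vvec n j‖ ≤ 2 / (n : ℝ) - 2 * t) :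
    ‖u - t • vvec n i‖ ≤ 1 - t := by
  have hcard : (0 : ℝ) < A.card := by exact_mod_cast Finset.card_pos.2 ⟨i, hi⟩
  have hcn : (A.card : ℝ) ≤ n := by exact_mod_cast (by simpa using A.card_le_univ)
  have hinv : 2 / (n : ℝ) ≤ 2 / A.card := by gcongr
  refine (pi_norm_le_iff_of_nonneg (by linarith)).2 fun m => ?_
  have hum := abs_le.1 ((norm_le_pi_norm u m).trans hu)
  have hdm := abs_le.1 ((norm_le_pi_norm _ m).trans hclose)
  simp only [Pi.sub_apply, Pi.smul_apply, Finset.sum_apply, smul_eq_mul] at hdm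
  have hsum : (2 - A.card : ℝ) ≤ ∑ j ∈ A, vvec n j m * vvec n i m := by
    have hterm : ∀ j ∈ A, (if j = i then 2 else 0) - 1 ≤ vvec n j m * vvec n i m := by
      intro j _
      split_ifs with h
      · subst h
        rcases vvec_eq_one_or n j m with h | h <;> norm_num [h]
      · rcases vvec_eq_one_or n j m with h | h <;>
          rcases vvec_eq_one_or n i m with h' | h' <;> norm_num [h, h']
    simpa [Finset.sum_sub_distrib, hi] using Finset.sum_le_sum hterm
  have havg : 2 / (A.card : ℝ) - 1 ≤ (A.card : ℝ)⁻¹ * (∑ j ∈ A, vvec n j m) * vvec n i m := by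
    rw [mul_assoc, Finset.sum_mul]
    calc 2 / (A.card : ℝ) - 1 = (A.card : ℝ)⁻¹ * (2 - A.card) := by field_simp
      _ ≤ _ := by gcongr
  simp only [Pi.sub_apply, Pi.smul_apply, smul_eq_mul, Real.norm_eq_abs]
  rw [abs_le]
  rcases vvec_eq_one_or n i m with h | h <;> rw [h] at havg ⊢ <;> constructor <;> linarith

/-- if the pair `(ℓ∞ⁿ, Y)` has the BPBp with function `η`, then `Y` has the
AHSp-ℓ∞ⁿ with the function `γ(ε) = η(ε/(n(n+1)))`. -/
theorem stmt14 (Y : Type*) [NormedAddCommGroup Y] [NormedSpace ℝ Y] [CompleteSpace Y]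
    (n : ℕ) (hn : 0 < n) (η : ℝ → ℝ)
    (h : BPBpWith (Fin n → ℝ) Y η) :
    AHSpWith Y n (fun ε => η (ε / ((n : ℝ) * ((n : ℝ) + 1)))) := by
  intro ε hε hε1
  have hn1 : (1 : ℝ) ≤ n := by exact_mod_cast hn
  set δ := ε / ((n : ℝ) * ((n : ℝ) + 1)) with hδ
  have hδ0 : 0 < δ := by positivity
  have hδε : 2 * δ ≤ ε := by
    rw [hδ, ← mul_div_assoc, div_le_iff₀ (by positivity)]
    nlinarith [mul_nonneg hε.le (sub_nonneg.2 hn1)]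
  have hδn : δ ≤ 1 / n := by
    rw [hδ, div_le_div_iff₀ (by positivity) (by positivity)]
    nlinarith [mul_pos (by linarith : (0 : ℝ) < n) (by linarith : (0 : ℝ) < n)]
  obtain ⟨⟨hη0, hηδ⟩, hBPB⟩ := h δ hδ0 (by linarith)
  refine ⟨⟨hη0, by linarith⟩, fun y hy A hA f hf hfA => ?_⟩
  have hcard : (0 : ℝ) < A.card := by exact_mod_cast hA.card_pos
  set T := LinearMap.toContinuousLinearMap (vvecLift n hn y)
  have hT : ∀ i, T (vvec n i) = y i := vvecLift_vvec n hn y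
  have hT1 : ‖T‖ ≤ 1 := norm_vvecLift_le hn hy
  set x₀ : Fin n → ℝ := (A.card : ℝ)⁻¹ • ∑ i ∈ A, vvec n i with hx₀
  have hx₀1 : ‖x₀‖ = 1 := norm_avg_vvec hn hA
  have hTx₀ : 1 - η δ < ‖T x₀‖ := by
    have hlt : (A.card : ℝ) * (1 - η δ) < ∑ i ∈ A, f (y i) := by
      rw [← nsmul_eq_mul, ← Finset.sum_const]
      exact Finset.sum_lt_sum_of_nonempty hA hfA
    calc 1 - η δ < (A.card : ℝ)⁻¹ * ∑ i ∈ A, f (y i) := by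
          rwa [lt_inv_mul_iff₀ hcard]
      _ = f (T x₀) := by simp [hx₀, hT]
      _ ≤ ‖T x₀‖ := by simpa [hf] using (le_abs_self _).trans (f.le_opNorm (T x₀))
  have hTx₀T : ‖T x₀‖ ≤ ‖T‖ := by simpa [hx₀1] using T.le_opNorm x₀
  have hTpos : 0 < ‖T‖ := by linarith
  obtain ⟨S, hS, u₀, hu₀, hSu₀, hux, hST⟩ := hBPB (‖T‖⁻¹ • T)
    (by rw [norm_smul, norm_inv, norm_norm, inv_mul_cancel₀ hTpos.ne']) x₀ hx₀1 (by
      rw [smul_apply, norm_smul, norm_inv, norm_norm]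
      exact hTx₀.trans_le (le_mul_of_one_le_left (norm_nonneg _) ((one_le_inv₀ hTpos).2 hT1)))
  have hnormalize : ‖‖T‖⁻¹ • T - T‖ < δ := by
    have hsub : ‖T‖⁻¹ • T - T = (‖T‖⁻¹ - 1) • T := by module
    rw [hsub, norm_smul, Real.norm_of_nonneg (sub_nonneg.2 ((one_le_inv₀ hTpos).2 hT1)), sub_mul,
      inv_mul_cancel₀ hTpos.ne']
    linarith
  have hdist : ‖S - T‖ < ε := by
    linarith [norm_sub_le_norm_sub_add_norm_sub S (‖T‖⁻¹ • T) T]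
  have hv : ∀ i, ‖vvec n i‖ ≤ 1 := fun i =>
    (pi_norm_le_iff_of_nonneg zero_le_one).2 fun j => (norm_vvec_apply n i j).le
  refine ⟨fun i => S (vvec n i), apply_vvec_mem_MSet S hS.le, fun i => ?_, ?_⟩
  · rw [← hT i, ← sub_apply]
    exact ((S - T).le_of_opNorm_le_of_le le_rfl (hv i)).trans_lt (by linarith)
  · obtain ⟨φ, hφ, hφu⟩ := exists_dual_vector'' ℝ (S u₀)
    have hφS : ‖φ.comp S‖ ≤ 1 :=
      (φ.opNorm_comp_le S).trans (by rw [hS, mul_one]; exact hφ)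
    have hge : ∀ i ∈ A, 1 ≤ φ (S (vvec n i)) := fun i hi =>
      one_le_apply_of_norm_sub_smul_le hφS (t := 1 / (2 * n)) (by positivity)
        (by simpa [hSu₀] using hφu)
        (norm_sub_smul_vvec_le hi hu₀.le
          (by rw [div_le_one (by positivity)]; linarith)
          (hux.le.trans (hδn.trans (le_of_eq (by field_simp; norm_num)))))
    refine le_antisymm ?_ ?_
    · have hle : ∀ i ∈ A, ‖S (vvec n i)‖ ≤ 1 := fun i _ => by
        simpa using S.le_of_opNorm_le_of_le hS.le (hv i)
      simpa using norm_sum_le_of_le A hle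
    · calc (A.card : ℝ) ≤ ∑ i ∈ A, φ (S (vvec n i)) := by simpa using Finset.sum_le_sum hge
        _ = φ (∑ i ∈ A, S (vvec n i)) := (map_sum φ _ A).symm
        _ ≤ 1 * ‖∑ i ∈ A, S (vvec n i)‖ :=
          (le_abs_self _).trans (φ.le_of_opNorm_le hφ _)
        _ = _ := one_mul _
end
end
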